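/- Let (H,G) be the canonical time-dependent spray of a relativistic rheonomic Lagrange space RL^n = (J^1(R,M), L), with H^{(i)}_{(1)1} = −(1/2)H^1_{11}y^i and G^{(i)}_{(1)1} as determined by the Euler–Lagrange equations of L. Then the pair of local function families Γ = (M^{(i)}_{(1)1}, N^{(i)}_{(1)j}), with M^{(i)}_{(1)1} = 2H^{(i)}_{(1)1} = −H^1_{11}y^i and N^{(i)}_{(1)j} = ∂G^{(i)}_{(1)1}/∂y^j, satisfies the temporal and spatial nonlinear connection transformation laws, i.e. it defines a nonlinear connection on J^1(R,M) (the canonical nonlinear connection of RL^n). -/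

import Mathlib

noncomputable section

open scoped BigOperators

/-- Local spatial coordinates (fibre ℝⁿ). -/
abbrev Vec (n : ℕ) : Type := Fin n → ℝ

/-- Local coordinates `(t, xⁱ, yⁱ)` on the 1-jet bundle `J¹(ℝ, M)`. -/
abbrev J1 (n : ℕ) : Type := ℝ × Vec n × Vec n

namespace Jet

variable {n : ℕ}

/-- Partial derivative in the temporal variable `t`. -/
def pt (f : J1 n → ℝ) (p : J1 n) : ℝ := deriv (fun s => f (s, p.2)) p.1

/-- Partial derivative in the spatial variable `x^j`. -/
def px (f : J1 n → ℝ) (j : Fin n) (p : J1 n) : ℝ :=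
  deriv (fun s => f (p.1, Function.update p.2.1 j s, p.2.2)) (p.2.1 j)

/-- Partial derivative in the fibre variable `y^j`. -/
def py (f : J1 n → ℝ) (j : Fin n) (p : J1 n) : ℝ :=
  deriv (fun s => f (p.1, p.2.1, Function.update p.2.2 j s)) (p.2.2 j)

/-- Partial derivative of a function of the spatial variables only. -/
def pX (f : Vec n → ℝ) (j : Fin n) (x : Vec n) : ℝ :=
  deriv (fun s => f (Function.update x j s)) (x j)

/-- A change of coordinates `t̃ = t̃(t)`, `x̃ⁱ = x̃ⁱ(xʲ)` on the base `ℝ × M`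
(a gauge transformation of the bundle of configurations). -/
structure CoordChange (n : ℕ) where
  τ : ℝ → ℝ
  τinv : ℝ → ℝ
  σ : Vec n → Vec n
  σinv : Vec n → Vec n
  left_τ : Function.LeftInverse τinv τ
  right_τ : Function.RightInverse τinv τ
  left_σ : Function.LeftInverse σinv σ
  right_σ : Function.RightInverse σinv σ
  smooth_τ : ContDiff ℝ (⊤ : ℕ∞) τ
  smooth_τinv : ContDiff ℝ (⊤ : ℕ∞) τinv
  smooth_σ : ContDiff ℝ (⊤ : ℕ∞) σ
  smooth_σinv : ContDiff ℝ (⊤ : ℕ∞) σinv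

namespace CoordChange

variable (c : CoordChange n)

/-- `dt̃/dt`. -/
def dτ (t : ℝ) : ℝ := deriv c.τ t

/-- `dt/dt̃`, evaluated at `t̃ = τ t`. -/
def dτinv (t : ℝ) : ℝ := deriv c.τinv (c.τ t)

/-- The Jacobian `∂x̃^k/∂x^j`. -/
def Jac (k j : Fin n) (x : Vec n) : ℝ := pX (fun z => c.σ z k) j x

/-- The inverse Jacobian `∂x^i/∂x̃^j`, evaluated at `x̃ = σ x`. -/
def JacInv (i j : Fin n) (x : Vec n) : ℝ := pX (fun z => c.σinv z i) j (c.σ x)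

/-- The induced change of the fibre coordinates:
`ỹⁱ = (∂x̃ⁱ/∂xʲ)(dt/dt̃) yʲ`. -/
def yc (p : J1 n) : Vec n := fun i => (∑ j, c.Jac i j p.2.1 * p.2.2 j) * c.dτinv p.1

/-- The induced change of coordinates on `J¹(ℝ,M)`. -/
def Φ (p : J1 n) : J1 n := (c.τ p.1, c.σ p.2.1, c.yc p)

end CoordChange

/-- The transformation law of the local components of a temporal spray:
`2H̃⁽ᵏ⁾ = 2H⁽ʲ⁾ (dt/dt̃)² (∂x̃ᵏ/∂xʲ) − (dt/dt̃)(∂ỹᵏ/∂t)`. -/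
def TemporalSprayLaw (c : CoordChange n) (H H' : J1 n → Fin n → ℝ) : Prop :=
  ∀ (p : J1 n) (k : Fin n),
    2 * H' (c.Φ p) k =
      (∑ j, 2 * H p j * (c.dτinv p.1) ^ 2 * c.Jac k j p.2.1) -
        c.dτinv p.1 * pt (fun q => c.yc q k) p

/-- The transformation law of the local components of a spatial spray:
`2G̃⁽ᵏ⁾ = 2G⁽ʲ⁾ (dt/dt̃)² (∂x̃ᵏ/∂xʲ) − (∂xⁱ/∂x̃ʲ)(∂ỹᵏ/∂xⁱ) ỹʲ`. -/
def SpatialSprayLaw (c : CoordChange n) (G G' : J1 n → Fin n → ℝ) : Prop :=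
  ∀ (p : J1 n) (k : Fin n),
    2 * G' (c.Φ p) k =
      (∑ j, 2 * G p j * (c.dτinv p.1) ^ 2 * c.Jac k j p.2.1) -
        ∑ j, ∑ i, c.JacInv i j p.2.1 * px (fun q => c.yc q k) i p * c.yc p j

/-- The transformation law of a temporal nonlinear connection:
`M̃⁽ʲ⁾(dt̃/dt) = M⁽ᵏ⁾(dt/dt̃)(∂x̃ʲ/∂xᵏ) − ∂ỹʲ/∂t`. -/
def TemporalNLCLaw (c : CoordChange n) (M M' : J1 n → Fin n → ℝ) : Prop :=
  ∀ (p : J1 n) (j : Fin n),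
    M' (c.Φ p) j * c.dτ p.1 =
      (∑ k, M p k * c.dτinv p.1 * c.Jac j k p.2.1) - pt (fun q => c.yc q j) p

/-- The transformation law of a spatial nonlinear connection:
`Ñ⁽ʲ⁾₍ₖ₎(∂x̃ᵏ/∂xⁱ) = N⁽ᵏ⁾₍ᵢ₎(dt/dt̃)(∂x̃ʲ/∂xᵏ) − ∂ỹʲ/∂xⁱ`. -/
def SpatialNLCLaw (c : CoordChange n) (N N' : J1 n → Fin n → Fin n → ℝ) : Prop :=
  ∀ (p : J1 n) (j i : Fin n),
    (∑ k, N' (c.Φ p) j k * c.Jac k i p.2.1) =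
      (∑ k, N p k i * c.dτinv p.1 * c.Jac j k p.2.1) - px (fun q => c.yc q j) i p

/-- Transformation law of a (semi-Riemannian) temporal metric `h₁₁(t)`. -/
def TemporalMetricLaw (c : CoordChange n) (h h' : ℝ → ℝ) : Prop :=
  ∀ t : ℝ, h' (c.τ t) = h t * (c.dτinv t) ^ 2

/-- Transformation law of a (semi-Riemannian) spatial metric `φᵢⱼ(x)`. -/
def SpatialMetricLaw (c : CoordChange n) (φ φ' : Vec n → Matrix (Fin n) (Fin n) ℝ) : Prop :=
  ∀ (x : Vec n) (i j : Fin n),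
    φ' (c.σ x) i j = ∑ k, ∑ l, φ x k l * c.JacInv k i x * c.JacInv l j x

/-- The Christoffel symbol `H¹₁₁ = (h¹¹/2) dh₁₁/dt` of a temporal metric. -/
def christoffelT (h : ℝ → ℝ) (t : ℝ) : ℝ := deriv h t / (2 * h t)

/-- The Christoffel symbols `γⁱⱼₖ` of a spatial metric `φ`. -/
def christoffelS (φ : Vec n → Matrix (Fin n) (Fin n) ℝ) (i j k : Fin n) (x : Vec n) : ℝ :=
  (1 / 2) * ∑ m, (φ x)⁻¹ i m *
    (pX (fun z => φ z m j) k x + pX (fun z => φ z m k) j x - pX (fun z => φ z j k) m x)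

/-- Kronecker `h`-regularity of a Lagrangian function. -/
def KroneckerHRegular {n : ℕ} (h : ℝ → ℝ) (L : J1 n → ℝ)
    (g : J1 n → Matrix (Fin n) (Fin n) ℝ) : Prop :=
  ∀ (p : J1 n) (i j : Fin n),
    (1 / 2) * py (fun q => py L i q) j p = (1 / h p.1) * g p i j

/-- The canonical spatial spray of a relativistic rheonomic Lagrange space. -/
def canonicalG {n : ℕ} (h : ℝ → ℝ) (L : J1 n → ℝ)
    (g : J1 n → Matrix (Fin n) (Fin n) ℝ) (p : J1 n) (i : Fin n) : ℝ :=
  (h p.1 / 4) * ∑ k, (g p)⁻¹ i k *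
    ((∑ j, px (fun q => py L k q) j p * p.2.2 j) - px L k p +
      pt (fun q => py L k q) p + py L k p * christoffelT h p.1 +
      2 * (1 / h p.1) * christoffelT h p.1 * ∑ l, g p k l * p.2.2 l)

section PartialDerivatives

variable {f : J1 n → ℝ}

lemma hasDerivAt_pt (hf : Differentiable ℝ f) (p : J1 n) :
    HasDerivAt (fun s => f (s, p.2)) (pt f p) p.1 := by
  unfold pt
  exact DifferentiableAt.hasDerivAt (by fun_prop)

lemma hasDerivAt_px (hf : Differentiable ℝ f) (j : Fin n) (p : J1 n) :
    HasDerivAt (fun s => f (p.1, Function.update p.2.1 j s, p.2.2)) (px f j p) (p.2.1 j) := by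
  have hu := (hasDerivAt_update p.2.1 j (p.2.1 j)).differentiableAt
  unfold px
  exact DifferentiableAt.hasDerivAt (by fun_prop)

lemma hasDerivAt_py (hf : Differentiable ℝ f) (j : Fin n) (p : J1 n) :
    HasDerivAt (fun s => f (p.1, p.2.1, Function.update p.2.2 j s)) (py f j p) (p.2.2 j) := by
  have hu := (hasDerivAt_update p.2.2 j (p.2.2 j)).differentiableAt
  unfold py
  exact DifferentiableAt.hasDerivAt (by fun_prop)

lemma hasDerivAt_pX {f : Vec n → ℝ} (hf : Differentiable ℝ f) (j : Fin n) (x : Vec n) :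
    HasDerivAt (fun s => f (Function.update x j s)) (pX f j x) (x j) := by
  have hu := (hasDerivAt_update x j (x j)).differentiableAt
  unfold pX
  exact DifferentiableAt.hasDerivAt (by fun_prop)

lemma pt_eq_fderiv (hf : Differentiable ℝ f) (p : J1 n) :
    pt f p = fderiv ℝ f p (1, 0, 0) := by
  have hc : HasDerivAt (fun s => (s, p.2)) ((1, 0, 0) : J1 n) p.1 :=
    (hasDerivAt_id p.1).prodMk (hasDerivAt_const p.1 p.2)
  exact ((hf p).hasFDerivAt.comp_hasDerivAt p.1 hc).deriv

lemma px_eq_fderiv (hf : Differentiable ℝ f) (j : Fin n) (p : J1 n) :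
    px f j p = fderiv ℝ f p (0, Pi.single j 1, 0) := by
  have hc : HasDerivAt (fun s => (p.1, Function.update p.2.1 j s, p.2.2))
      ((0, Pi.single j 1, 0) : J1 n) (p.2.1 j) :=
    (hasDerivAt_const _ _).prodMk ((hasDerivAt_update _ _ _).prodMk (hasDerivAt_const _ _))
  exact ((hf p).hasFDerivAt.comp_hasDerivAt_of_eq (p.2.1 j) hc (by simp)).deriv

lemma py_eq_fderiv (hf : Differentiable ℝ f) (j : Fin n) (p : J1 n) :
    py f j p = fderiv ℝ f p (0, 0, Pi.single j 1) := by
  have hc : HasDerivAt (fun s => (p.1, p.2.1, Function.update p.2.2 j s))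
      ((0, 0, Pi.single j 1) : J1 n) (p.2.2 j) :=
    (hasDerivAt_const _ _).prodMk ((hasDerivAt_const _ _).prodMk (hasDerivAt_update _ _ _))
  exact ((hf p).hasFDerivAt.comp_hasDerivAt_of_eq (p.2.2 j) hc (by simp)).deriv

lemma pX_eq_fderiv {f : Vec n → ℝ} (hf : Differentiable ℝ f) (j : Fin n) (x : Vec n) :
    pX f j x = fderiv ℝ f x (Pi.single j 1) :=
  ((hf x).hasFDerivAt.comp_hasDerivAt_of_eq (x j) (hasDerivAt_update x j (x j)) (by simp)).deriv

lemma contDiff_fderiv_apply {E : Type*} [NormedAddCommGroup E] [NormedSpace ℝ E] {f : E → ℝ}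
    (hf : ContDiff ℝ (⊤ : ℕ∞) f) (v : E) :
    ContDiff ℝ (⊤ : ℕ∞) (fun p => fderiv ℝ f p v) :=
  (hf.fderiv_right (by norm_cast)).clm_apply contDiff_const

lemma contDiff_differentiable {E F : Type*} [NormedAddCommGroup E] [NormedSpace ℝ E]
    [NormedAddCommGroup F] [NormedSpace ℝ F] {f : E → F}
    (hf : ContDiff ℝ (⊤ : ℕ∞) f) : Differentiable ℝ f :=
  hf.differentiable (by simp)

lemma contDiff_pt (hf : ContDiff ℝ (⊤ : ℕ∞) f) : ContDiff ℝ (⊤ : ℕ∞) (pt f) := by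
  rw [funext (pt_eq_fderiv (contDiff_differentiable hf))]
  exact contDiff_fderiv_apply hf _

lemma contDiff_px (hf : ContDiff ℝ (⊤ : ℕ∞) f) (j : Fin n) :
    ContDiff ℝ (⊤ : ℕ∞) (px f j) := by
  rw [funext (px_eq_fderiv (contDiff_differentiable hf) j)]
  exact contDiff_fderiv_apply hf _

lemma contDiff_py (hf : ContDiff ℝ (⊤ : ℕ∞) f) (j : Fin n) :
    ContDiff ℝ (⊤ : ℕ∞) (py f j) := by
  rw [funext (py_eq_fderiv (contDiff_differentiable hf) j)]
  exact contDiff_fderiv_apply hf _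

lemma contDiff_pX {f : Vec n → ℝ} (hf : ContDiff ℝ (⊤ : ℕ∞) f) (j : Fin n) :
    ContDiff ℝ (⊤ : ℕ∞) (pX f j) := by
  rw [funext (pX_eq_fderiv (contDiff_differentiable hf) j)]
  exact contDiff_fderiv_apply hf _

lemma pX_comm {f : Vec n → ℝ} (hf : ContDiff ℝ (⊤ : ℕ∞) f) (i j : Fin n) (x : Vec n) :
    pX (pX f i) j x = pX (pX f j) i x := by
  have hd : DifferentiableAt ℝ (fderiv ℝ f) x :=
    contDiff_differentiable (hf.fderiv_right (m := (⊤ : ℕ∞)) (by norm_cast)) x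
  have key (i j : Fin n) : pX (pX f i) j x =
      fderiv ℝ (fderiv ℝ f) x (Pi.single j 1) (Pi.single i 1) := by
    rw [pX_eq_fderiv (contDiff_differentiable (contDiff_pX hf i)),
      funext (pX_eq_fderiv (contDiff_differentiable hf) i),
      fderiv_clm_apply hd (differentiableAt_const _)]
    simp
  rw [key, key]
  exact (hf.contDiffAt.isSymmSndFDerivAt (by simpa using WithTop.coe_le_coe.2 (le_top (a := (2 : ℕ∞))))) _ _

lemma fderiv_apply_eq_sum (hf : Differentiable ℝ f) (p : J1 n) (a : ℝ) (b w : Vec n) :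
    fderiv ℝ f p (a, b, w) =
      pt f p * a + ∑ j, px f j p * b j + ∑ j, py f j p * w j := by
  have hsum : ((a, b, w) : J1 n) = a • ((1, 0, 0) : J1 n) +
      ∑ j, b j • ((0, Pi.single j 1, 0) : J1 n) + ∑ j, w j • ((0, 0, Pi.single j 1) : J1 n) := by
    ext i <;> simp [Prod.fst_sum, Prod.snd_sum, Finset.sum_apply, Pi.single_apply]
  rw [hsum]
  simp only [map_add, map_sum, map_smul, pt_eq_fderiv hf, px_eq_fderiv hf, py_eq_fderiv hf,
    smul_eq_mul, mul_comm]

lemma hasDerivAt_comp_curve (hf : Differentiable ℝ f) {a : ℝ → ℝ} {b w : ℝ → Vec n}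
    {a' s : ℝ} {b' w' : Vec n} {p : J1 n} (hp : (a s, b s, w s) = p)
    (ha : HasDerivAt a a' s) (hb : HasDerivAt b b' s) (hw : HasDerivAt w w' s) :
    HasDerivAt (fun s => f (a s, b s, w s))
      (pt f p * a' + ∑ j, px f j p * b' j + ∑ j, py f j p * w' j) s := by
  rw [← fderiv_apply_eq_sum hf]
  exact (hf p).hasFDerivAt.comp_hasDerivAt_of_eq s (ha.prodMk (hb.prodMk hw)) hp.symm

end PartialDerivatives

namespace CoordChange

variable (c : CoordChange n)

lemma contDiff_component (k : Fin n) : ContDiff ℝ (⊤ : ℕ∞) (fun z => c.σ z k) :=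
  contDiff_pi.1 c.smooth_σ k

lemma contDiff_Jac (k j : Fin n) : ContDiff ℝ (⊤ : ℕ∞) (c.Jac k j) :=
  contDiff_pX (c.contDiff_component k) j

lemma contDiff_dτinv : ContDiff ℝ (⊤ : ℕ∞) c.dτinv := by
  have h : ContDiff ℝ (⊤ : ℕ∞) (deriv c.τinv) := ContDiff.deriv' c.smooth_τinv
  exact h.comp c.smooth_τ

lemma contDiff_yc (k : Fin n) : ContDiff ℝ (⊤ : ℕ∞) (fun q => c.yc q k) := by
  have hJ := c.contDiff_Jac
  have hκ := c.contDiff_dτinv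
  unfold yc
  fun_prop

lemma dτinv_mul_dτ (t : ℝ) : c.dτinv t * c.dτ t = 1 := by
  have h1 := (contDiff_differentiable c.smooth_τinv (c.τ t)).hasDerivAt
  have h2 := (contDiff_differentiable c.smooth_τ t).hasDerivAt
  have h3 := h1.comp t h2
  rw [show c.τinv ∘ c.τ = id from funext c.left_τ] at h3
  exact h3.unique (hasDerivAt_id t)

lemma dτinv_ne_zero (t : ℝ) : c.dτinv t ≠ 0 :=
  left_ne_zero_of_mul_eq_one (c.dτinv_mul_dτ t)

lemma pX_Jac_comm (a j k : Fin n) (x : Vec n) : pX (c.Jac a j) k x = pX (c.Jac a k) j x :=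
  pX_comm (c.contDiff_component a) j k x

lemma isUnit_det_Jac (x : Vec n) : IsUnit (Matrix.of fun i j => c.Jac i j x).det := by
  have h1 := (contDiff_differentiable c.smooth_σinv (c.σ x)).hasFDerivAt
  have h2 := (contDiff_differentiable c.smooth_σ x).hasFDerivAt
  have h3 := h1.comp x h2
  rw [show c.σinv ∘ c.σ = id from funext c.left_σ] at h3
  have h4 := h3.unique (hasFDerivAt_id x)
  have hJ : (Matrix.of fun i j => c.Jac i j x) =
      LinearMap.toMatrix' (fderiv ℝ c.σ x).toLinearMap := by
    ext i j
    rw [LinearMap.toMatrix'_apply, Matrix.of_apply, Jac,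
      pX_eq_fderiv (contDiff_differentiable (c.contDiff_component i))]
    rw [fderiv_apply (contDiff_differentiable c.smooth_σ x) i]
    rfl
  have h5 : LinearMap.toMatrix' (fderiv ℝ c.σinv (c.σ x)).toLinearMap *
      LinearMap.toMatrix' (fderiv ℝ c.σ x).toLinearMap = 1 := by
    rw [← LinearMap.toMatrix'_comp, ← ContinuousLinearMap.toLinearMap_comp, h4]
    exact LinearMap.toMatrix'_id
  rw [hJ]
  exact Matrix.isUnit_det_of_left_inverse h5

lemma pt_yc (p : J1 n) (k : Fin n) :
    pt (fun q => c.yc q k) p = (∑ j, c.Jac k j p.2.1 * p.2.2 j) * deriv c.dτinv p.1 :=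
  ((contDiff_differentiable c.contDiff_dτinv p.1).hasDerivAt.const_mul
    (∑ j, c.Jac k j p.2.1 * p.2.2 j)).deriv

lemma px_yc (p : J1 n) (k i : Fin n) :
    px (fun q => c.yc q k) i p = (∑ j, pX (c.Jac k j) i p.2.1 * p.2.2 j) * c.dτinv p.1 :=
  ((HasDerivAt.fun_sum fun j _ =>
    (hasDerivAt_pX (contDiff_differentiable (c.contDiff_Jac k j)) i p.2.1).mul_const
      (p.2.2 j)).mul_const (c.dτinv p.1)).deriv

lemma hasDerivAt_sum_mul_update (a y : Vec n) (i : Fin n) :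
    HasDerivAt (fun s => ∑ j, a j * Function.update y i s j) (a i) (y i) := by
  have h := HasDerivAt.fun_sum (u := Finset.univ) fun j _ =>
    ((hasDerivAt_pi.1 (hasDerivAt_update y i (y i))) j).const_mul (a j)
  simpa [Pi.single_apply] using h

lemma hasDerivAt_yc_fibre (p : J1 n) (k i : Fin n) :
    HasDerivAt (fun s => c.yc (p.1, p.2.1, Function.update p.2.2 i s) k)
      (c.Jac k i p.2.1 * c.dτinv p.1) (p.2.2 i) :=
  (hasDerivAt_sum_mul_update (fun j => c.Jac k j p.2.1) p.2.2 i).mul_const (c.dτinv p.1)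

variable {F : J1 n → ℝ}

lemma hasDerivAt_comp_Φ_time (hF : Differentiable ℝ F) (p : J1 n) :
    HasDerivAt (fun s => F (c.Φ (s, p.2)))
      (pt F (c.Φ p) * c.dτ p.1 + ∑ b, py F b (c.Φ p) * pt (fun q => c.yc q b) p) p.1 := by
  have h := hasDerivAt_comp_curve hF (p := c.Φ p) rfl
    (contDiff_differentiable c.smooth_τ p.1).hasDerivAt (hasDerivAt_const p.1 (c.σ p.2.1))
    (hasDerivAt_pi.2 fun b => hasDerivAt_pt (contDiff_differentiable (c.contDiff_yc b)) p)
  simpa [Φ, dτ, Jac] using h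

lemma hasDerivAt_comp_Φ_space (hF : Differentiable ℝ F) (p : J1 n) (i : Fin n) :
    HasDerivAt (fun s => F (c.Φ (p.1, Function.update p.2.1 i s, p.2.2)))
      (∑ b, px F b (c.Φ p) * c.Jac b i p.2.1 +
        ∑ b, py F b (c.Φ p) * px (fun q => c.yc q b) i p) (p.2.1 i) := by
  have h := hasDerivAt_comp_curve hF (p := c.Φ p) (by simp [Φ])
    (hasDerivAt_const (p.2.1 i) (c.τ p.1))
    (hasDerivAt_pi.2 fun b =>
      hasDerivAt_pX (contDiff_differentiable (c.contDiff_component b)) i p.2.1)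
    (hasDerivAt_pi.2 fun b => hasDerivAt_px (contDiff_differentiable (c.contDiff_yc b)) i p)
  simpa [Φ, dτ, Jac] using h

lemma hasDerivAt_comp_Φ_fibre (hF : Differentiable ℝ F) (p : J1 n) (i : Fin n) :
    HasDerivAt (fun s => F (c.Φ (p.1, p.2.1, Function.update p.2.2 i s)))
      (∑ b, py F b (c.Φ p) * (c.Jac b i p.2.1 * c.dτinv p.1)) (p.2.2 i) := by
  have h := hasDerivAt_comp_curve hF (p := c.Φ p) (by simp [Φ])
    (hasDerivAt_const (p.2.2 i) (c.τ p.1)) (hasDerivAt_const (p.2.2 i) (c.σ p.2.1))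
    (hasDerivAt_pi.2 fun b => c.hasDerivAt_yc_fibre p b i)
  simpa [Φ] using h

end CoordChange

namespace CoordChange

variable (c : CoordChange n) {F : J1 n → ℝ}

lemma px_comp_Φ (hF : Differentiable ℝ F) (p : J1 n) (k : Fin n) :
    px (fun q => F (c.Φ q)) k p =
      ∑ a, (px F a (c.Φ p) * c.Jac a k p.2.1 +
        py F a (c.Φ p) * px (fun q => c.yc q a) k p) := by
  rw [Finset.sum_add_distrib]
  exact (c.hasDerivAt_comp_Φ_space hF p k).deriv

lemma py_comp_Φ (hF : Differentiable ℝ F) (k : Fin n) :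
    py (fun q => F (c.Φ q)) k =
      fun p => ∑ a, py F a (c.Φ p) * (c.Jac a k p.2.1 * c.dτinv p.1) :=
  funext fun p => (c.hasDerivAt_comp_Φ_fibre hF p k).deriv

lemma py_py_comp_Φ (hF : ContDiff ℝ (⊤ : ℕ∞) F) (p : J1 n) (k j : Fin n) :
    py (py (fun q => F (c.Φ q)) k) j p =
      ∑ a, (∑ b, py (py F a) b (c.Φ p) * (c.Jac b j p.2.1 * c.dτinv p.1)) *
        (c.Jac a k p.2.1 * c.dτinv p.1) := by
  rw [c.py_comp_Φ (contDiff_differentiable hF)]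
  exact (HasDerivAt.fun_sum fun a _ => (c.hasDerivAt_comp_Φ_fibre
    (contDiff_differentiable (contDiff_py hF a)) p j).mul_const
      (c.Jac a k p.2.1 * c.dτinv p.1)).deriv

lemma px_py_comp_Φ (hF : ContDiff ℝ (⊤ : ℕ∞) F) (p : J1 n) (k j : Fin n) :
    px (py (fun q => F (c.Φ q)) k) j p =
      ∑ a, ((∑ b, px (py F a) b (c.Φ p) * c.Jac b j p.2.1 +
          ∑ b, py (py F a) b (c.Φ p) * px (fun q => c.yc q b) j p) *
            (c.Jac a k p.2.1 * c.dτinv p.1) +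
        py F a (c.Φ p) * (pX (c.Jac a k) j p.2.1 * c.dτinv p.1)) := by
  rw [c.py_comp_Φ (contDiff_differentiable hF)]
  have h := HasDerivAt.fun_sum (u := Finset.univ) fun a _ => (c.hasDerivAt_comp_Φ_space
    (contDiff_differentiable (contDiff_py hF a)) p j).mul
      ((hasDerivAt_pX (contDiff_differentiable (c.contDiff_Jac a k)) j p.2.1).mul_const
        (c.dτinv p.1))
  simp only [Function.update_eq_self] at h
  exact h.deriv

lemma pt_py_comp_Φ (hF : ContDiff ℝ (⊤ : ℕ∞) F) (p : J1 n) (k : Fin n) :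
    pt (py (fun q => F (c.Φ q)) k) p =
      ∑ a, ((pt (py F a) (c.Φ p) * c.dτ p.1 +
          ∑ b, py (py F a) b (c.Φ p) * pt (fun q => c.yc q b) p) *
            (c.Jac a k p.2.1 * c.dτinv p.1) +
        py F a (c.Φ p) * (c.Jac a k p.2.1 * deriv c.dτinv p.1)) := by
  rw [c.py_comp_Φ (contDiff_differentiable hF)]
  exact (HasDerivAt.fun_sum (u := Finset.univ) fun a _ => (c.hasDerivAt_comp_Φ_time
    (contDiff_differentiable (contDiff_py hF a)) p).mul
      ((contDiff_differentiable c.contDiff_dτinv p.1).hasDerivAt.const_mul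
        (c.Jac a k p.2.1))).deriv

lemma christoffelT_transform {h h' : ℝ → ℝ} (law : TemporalMetricLaw c h h')
    (hd : Differentiable ℝ h) (hd' : Differentiable ℝ h') (hne : ∀ t, h t ≠ 0) (t : ℝ) :
    christoffelT h' (c.τ t) = c.dτinv t * christoffelT h t + deriv c.dτinv t := by
  have h1 : HasDerivAt (fun s => h' (c.τ s)) (deriv h' (c.τ t) * c.dτ t) t :=
    (hd' (c.τ t)).hasDerivAt.comp t (contDiff_differentiable c.smooth_τ t).hasDerivAt
  have h2 := (hd t).hasDerivAt.mul
    ((contDiff_differentiable c.contDiff_dτinv t).hasDerivAt.pow 2)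
  rw [show (fun s => h' (c.τ s)) = h * c.dτinv ^ 2 from funext law] at h1
  have h3 := h1.unique h2
  have h4 := c.dτinv_mul_dτ t
  have hκ := c.dτinv_ne_zero t
  have h5 : deriv h' (c.τ t) = c.dτinv t * (deriv h' (c.τ t) * c.dτ t) := by
    linear_combination (-deriv h' (c.τ t)) * h4
  have hn := hne t
  unfold christoffelT
  rw [h5, h3, law t]
  simp only [Pi.pow_apply]
  field_simp
  push_cast
  ring

end CoordChange

/-- The covector whose image under the inverse metric, scaled by `h₁₁/4`, is the canonical
spatial spray. -/
def sprayCovector (h : ℝ → ℝ) (L : J1 n → ℝ) (g : J1 n → Matrix (Fin n) (Fin n) ℝ)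
    (p : J1 n) (k : Fin n) : ℝ :=
  (∑ j, px (py L k) j p * p.2.2 j) - px L k p + pt (py L k) p +
    py L k p * christoffelT h p.1 +
    2 * (1 / h p.1) * christoffelT h p.1 * ∑ l, g p k l * p.2.2 l

lemma canonicalG_eq (h : ℝ → ℝ) (L : J1 n → ℝ) (g : J1 n → Matrix (Fin n) (Fin n) ℝ)
    (p : J1 n) : canonicalG h L g p = (h p.1 / 4) • (g p)⁻¹.mulVec (sprayCovector h L g p) :=
  rfl

lemma KroneckerHRegular.py_py {h : ℝ → ℝ} {L : J1 n → ℝ} {g : J1 n → Matrix (Fin n) (Fin n) ℝ}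
    (hreg : KroneckerHRegular h L g) (p : J1 n) (i j : Fin n) :
    py (py L i) j p = 2 / h p.1 * g p i j := by
  linear_combination 2 * hreg p i j

lemma KroneckerHRegular.metric_eq {h : ℝ → ℝ} {L : J1 n → ℝ}
    {g : J1 n → Matrix (Fin n) (Fin n) ℝ} (hreg : KroneckerHRegular h L g) (hne : ∀ t, h t ≠ 0)
    (p : J1 n) (i j : Fin n) : g p i j = h p.1 / 2 * py (py L i) j p := by
  have := hne p.1
  rw [hreg.py_py]
  field_simp

lemma contDiff_det {E : Type*} [NormedAddCommGroup E] [NormedSpace ℝ E]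
    {A : E → Matrix (Fin n) (Fin n) ℝ}
    (hA : ∀ i j, ContDiff ℝ (⊤ : ℕ∞) fun p => A p i j) :
    ContDiff ℝ (⊤ : ℕ∞) fun p => (A p).det := by
  simp only [Matrix.det_apply']
  exact ContDiff.sum fun σ _ => contDiff_const.mul (contDiff_prod fun i _ => hA _ _)

lemma contDiff_inv_apply {E : Type*} [NormedAddCommGroup E] [NormedSpace ℝ E]
    {A : E → Matrix (Fin n) (Fin n) ℝ}
    (hA : ∀ i j, ContDiff ℝ (⊤ : ℕ∞) fun p => A p i j) (hdet : ∀ p, IsUnit (A p).det)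
    (i j : Fin n) : ContDiff ℝ (⊤ : ℕ∞) fun p => (A p)⁻¹ i j := by
  simp only [Matrix.inv_def, Matrix.smul_apply, Ring.inverse_eq_inv, smul_eq_mul,
    Matrix.adjugate_apply]
  refine ((contDiff_det hA).inv fun p => (hdet p).ne_zero).mul (contDiff_det fun a b => ?_)
  by_cases hab : a = j
  · subst hab
    simpa using contDiff_const
  · simpa [Matrix.updateRow_ne hab] using hA a b

lemma contDiff_canonicalG {h : ℝ → ℝ} {L : J1 n → ℝ} {g : J1 n → Matrix (Fin n) (Fin n) ℝ}
    (hL : ContDiff ℝ (⊤ : ℕ∞) L) (hsm : ContDiff ℝ (⊤ : ℕ∞) h) (hne : ∀ t, h t ≠ 0)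
    (hreg : KroneckerHRegular h L g) (gunit : ∀ p, IsUnit (g p).det) (i : Fin n) :
    ContDiff ℝ (⊤ : ℕ∞) fun p => canonicalG h L g p i := by
  have hh : ContDiff ℝ (⊤ : ℕ∞) fun p : J1 n => h p.1 := hsm.comp contDiff_fst
  have hg (i j : Fin n) : ContDiff ℝ (⊤ : ℕ∞) fun p => g p i j := by
    simp only [hreg.metric_eq hne]
    exact (hh.div_const 2).mul (contDiff_py (contDiff_py hL i) j)
  have hginv := contDiff_inv_apply hg gunit
  have hpy := contDiff_py hL
  have hpx := contDiff_px hL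
  have hxy (k : Fin n) := contDiff_px (hpy k)
  have hty (k : Fin n) := contDiff_pt (hpy k)
  have hdh : ContDiff ℝ (⊤ : ℕ∞) (deriv h) := ContDiff.deriv' hsm
  have hH : ContDiff ℝ (⊤ : ℕ∞) fun p : J1 n => christoffelT h p.1 :=
    (hdh.comp contDiff_fst).div (contDiff_const.mul hh) fun p =>
      mul_ne_zero two_ne_zero (hne p.1)
  have hhi : ContDiff ℝ (⊤ : ℕ∞) fun p : J1 n => 1 / h p.1 :=
    contDiff_const.div hh fun p => hne p.1
  have hy (j : Fin n) : ContDiff ℝ (⊤ : ℕ∞) fun p : J1 n => p.2.2 j := by fun_prop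
  exact (hh.div_const 4).mul <| ContDiff.sum fun k _ => (hginv i k).mul <|
    ((((ContDiff.sum fun j _ => (hxy k j).mul (hy j)).sub (hpx k)).add (hty k)).add
      ((hpy k).mul hH)).add
        (((contDiff_const.mul hhi).mul hH).mul (ContDiff.sum fun l _ => (hg k l).mul (hy l)))

namespace CoordChange

variable (c : CoordChange n) {h h' : ℝ → ℝ} {F : J1 n → ℝ}
  {g g' : J1 n → Matrix (Fin n) (Fin n) ℝ}

/-- The Jacobian matrix `∂x̃ⁱ/∂xʲ`. -/
def jacMatrix (x : Vec n) : Matrix (Fin n) (Fin n) ℝ := Matrix.of fun i j => c.Jac i j x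

lemma metric_transform (law : TemporalMetricLaw c h h') (hF : ContDiff ℝ (⊤ : ℕ∞) F)
    (hne : ∀ t, h t ≠ 0) (hreg : KroneckerHRegular h (fun q => F (c.Φ q)) g)
    (hreg' : KroneckerHRegular h' F g') (p : J1 n) :
    g p = (c.jacMatrix p.2.1).transpose * (g' (c.Φ p) * c.jacMatrix p.2.1) := by
  ext k j
  have hκ := c.dτinv_ne_zero p.1
  have hn := hne p.1
  rw [hreg.metric_eq hne, c.py_py_comp_Φ hF, Matrix.mul_apply, Finset.mul_sum]
  refine Finset.sum_congr rfl fun a _ => ?_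
  simp only [hreg'.py_py, Matrix.transpose_apply, jacMatrix, Matrix.of_apply, Matrix.mul_apply,
    Finset.mul_sum, Finset.sum_mul]
  refine Finset.sum_congr rfl fun b _ => ?_
  rw [show (c.Φ p).1 = c.τ p.1 from rfl, law]
  field_simp

/-- The fibre vector `yʲ ∂ỹᵇ/∂xʲ`. -/
def fibreDrift (p : J1 n) (b : Fin n) : ℝ := ∑ j, px (fun q => c.yc q b) j p * p.2.2 j

lemma sprayCovector_transform (law : TemporalMetricLaw c h h') (hF : ContDiff ℝ (⊤ : ℕ∞) F)
    (hd : Differentiable ℝ h) (hd' : Differentiable ℝ h') (hne : ∀ t, h t ≠ 0)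
    (hreg : KroneckerHRegular h (fun q => F (c.Φ q)) g)
    (hreg' : KroneckerHRegular h' F g') (p : J1 n) :
    sprayCovector h (fun q => F (c.Φ q)) g p =
      (c.jacMatrix p.2.1).transpose.mulVec (sprayCovector h' F g' (c.Φ p) +
        (2 * c.dτinv p.1 / h' (c.τ p.1)) • (g' (c.Φ p)).mulVec (c.fibreDrift p)) := by
  ext k
  have hκ := c.dτinv_ne_zero p.1
  have hn := hne p.1
  have hτ := c.dτinv_mul_dτ p.1
  have hxy : ∑ j, px (py (fun q => F (c.Φ q)) k) j p * p.2.2 j =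
      ∑ a, ((∑ b, px (py F a) b (c.Φ p) * c.yc p b) * c.Jac a k p.2.1 +
        2 / h' (c.τ p.1) * (∑ b, g' (c.Φ p) a b * c.fibreDrift p b) *
          (c.Jac a k p.2.1 * c.dτinv p.1) +
        py F a (c.Φ p) * px (fun q => c.yc q a) k p) := by
    simp only [c.px_py_comp_Φ hF, Finset.sum_mul, px_yc, fibreDrift, hreg'.py_py]
    rw [Finset.sum_comm]
    refine Finset.sum_congr rfl fun a _ => ?_
    simp only [add_mul, Finset.sum_add_distrib, Finset.sum_mul, Finset.mul_sum, yc]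
    congr 1
    · congr 1
      · rw [Finset.sum_comm]
        refine Finset.sum_congr rfl fun b _ => Finset.sum_congr rfl fun j _ => ?_
        ring
      · rw [Finset.sum_comm]
        refine Finset.sum_congr rfl fun b _ => Finset.sum_congr rfl fun j _ =>
          Finset.sum_congr rfl fun l _ => ?_
        rw [show (c.Φ p).1 = c.τ p.1 from rfl]
        ring
    · refine Finset.sum_congr rfl fun j _ => ?_
      rw [c.pX_Jac_comm a k j]
      ring
  have hgy : ∑ l, g p k l * p.2.2 l =
      ∑ a, c.Jac a k p.2.1 * ∑ b, g' (c.Φ p) a b * ∑ l, c.Jac b l p.2.1 * p.2.2 l := by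
    change ((g p).mulVec p.2.2) k = _
    rw [c.metric_transform law hF hne hreg hreg', ← Matrix.mulVec_mulVec,
      ← Matrix.mulVec_mulVec]
    rfl
  rw [sprayCovector, hxy, hgy, c.px_comp_Φ (contDiff_differentiable hF), c.pt_py_comp_Φ hF,
    c.py_comp_Φ (contDiff_differentiable hF), Finset.sum_mul, Finset.mul_sum,
    ← Finset.sum_sub_distrib, ← Finset.sum_add_distrib, ← Finset.sum_add_distrib,
    ← Finset.sum_add_distrib]
  refine Finset.sum_congr rfl fun a _ => ?_
  simp only [hreg'.py_py, pt_yc, Pi.add_apply, Pi.smul_apply, smul_eq_mul, sprayCovector,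
    Matrix.transpose_apply, jacMatrix, Matrix.of_apply, Matrix.mulVec, dotProduct,
    show (c.Φ p).1 = c.τ p.1 from rfl, show (c.Φ p).2.2 = c.yc p from rfl,
    c.christoffelT_transform law hd hd' hne]
  have hS : ∑ b, g' (c.Φ p) a b * c.yc p b =
      (∑ b, g' (c.Φ p) a b * ∑ l, c.Jac b l p.2.1 * p.2.2 l) * c.dτinv p.1 := by
    simp only [yc, Finset.sum_mul, mul_assoc]
  have hS' : ∑ b, 2 / h' (c.τ p.1) * g' (c.Φ p) a b *
        ((∑ l, c.Jac b l p.2.1 * p.2.2 l) * deriv c.dτinv p.1) =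
      2 / h' (c.τ p.1) * (∑ b, g' (c.Φ p) a b * ∑ l, c.Jac b l p.2.1 * p.2.2 l) *
        deriv c.dτinv p.1 := by
    rw [Finset.mul_sum, Finset.sum_mul]
    exact Finset.sum_congr rfl fun b _ => by ring
  rw [hS, hS', law]
  generalize ∑ b, g' (c.Φ p) a b * ∑ l, c.Jac b l p.2.1 * p.2.2 l = S
  generalize ∑ b, g' (c.Φ p) a b * c.fibreDrift p b = Z
  generalize ∑ b, px (py F a) b (c.Φ p) * c.yc p b = A
  have hdτ : c.dτ p.1 = 1 / c.dτinv p.1 := by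
    field_simp
    linarith
  rw [hdτ]
  field_simp
  ring

lemma canonicalG_transform (law : TemporalMetricLaw c h h') (hF : ContDiff ℝ (⊤ : ℕ∞) F)
    (hd : Differentiable ℝ h) (hd' : Differentiable ℝ h') (hne : ∀ t, h t ≠ 0)
    (hreg : KroneckerHRegular h (fun q => F (c.Φ q)) g)
    (hreg' : KroneckerHRegular h' F g') (g'unit : ∀ p, IsUnit (g' p).det) (p : J1 n) :
    (c.dτinv p.1 ^ 2) • (c.jacMatrix p.2.1).mulVec (canonicalG h (fun q => F (c.Φ q)) g p) =
      canonicalG h' F g' (c.Φ p) + (c.dτinv p.1 / 2) • c.fibreDrift p := by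
  have hJ : IsUnit (c.jacMatrix p.2.1).det := c.isUnit_det_Jac p.2.1
  have hJT : IsUnit (c.jacMatrix p.2.1).transpose.det := by rwa [Matrix.det_transpose]
  have hκ := c.dτinv_ne_zero p.1
  have hn := hne p.1
  have hinv : c.jacMatrix p.2.1 * ((g p)⁻¹ * (c.jacMatrix p.2.1).transpose) =
      (g' (c.Φ p))⁻¹ := by
    rw [c.metric_transform law hF hne hreg hreg', Matrix.mul_inv_rev, Matrix.mul_inv_rev,
      Matrix.mul_assoc, Matrix.nonsing_inv_mul _ hJT, Matrix.mul_one, ← Matrix.mul_assoc,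
      Matrix.mul_nonsing_inv _ hJ, Matrix.one_mul]
  rw [canonicalG_eq, canonicalG_eq, c.sprayCovector_transform law hF hd hd' hne hreg hreg',
    Matrix.mulVec_smul, Matrix.mulVec_mulVec, Matrix.mulVec_mulVec, Matrix.mul_assoc, hinv, Matrix.mulVec_add,
    Matrix.mulVec_smul, Matrix.mulVec_mulVec, Matrix.nonsing_inv_mul _ (g'unit _),
    Matrix.one_mulVec, show (c.Φ p).1 = c.τ p.1 from rfl, law]
  ext a
  simp only [Pi.add_apply, Pi.smul_apply, smul_eq_mul]
  field_simp
  ring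

lemma hasDerivAt_fibreDrift (p : J1 n) (a m : Fin n) :
    HasDerivAt (fun s => c.fibreDrift (p.1, p.2.1, Function.update p.2.2 m s) a)
      (2 * px (fun q => c.yc q a) m p) (p.2.2 m) := by
  have h := HasDerivAt.fun_sum (u := Finset.univ) fun j _ =>
    ((hasDerivAt_sum_mul_update (fun l => pX (c.Jac a l) j p.2.1) p.2.2 m).mul_const
      (c.dτinv p.1)).mul (hasDerivAt_pi.1 (hasDerivAt_update p.2.2 m (p.2.2 m)) j)
  simp only [fibreDrift, px_yc]
  refine h.congr_deriv ?_
  simp only [Function.update_eq_self, Finset.sum_add_distrib, Pi.single_apply, mul_ite, mul_one,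
    mul_zero, Finset.sum_ite_eq', Finset.mem_univ, if_true, two_mul, Finset.sum_mul,
    c.pX_Jac_comm a m]
  congr 1
  exact Finset.sum_congr rfl fun j _ => by ring

/-- The temporal components `-H¹₁₁ yⁱ` form a temporal nonlinear connection. -/
lemma temporalNLCLaw_christoffelT (law : TemporalMetricLaw c h h')
    (hd : Differentiable ℝ h) (hd' : Differentiable ℝ h') (hne : ∀ t, h t ≠ 0) :
    TemporalNLCLaw c (fun p i => -(christoffelT h p.1) * p.2.2 i)
      (fun p i => -(christoffelT h' p.1) * p.2.2 i) := by
  intro p j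
  have hτ := c.dτinv_mul_dτ p.1
  have hsum : ∑ k, -christoffelT h p.1 * p.2.2 k * c.dτinv p.1 * c.Jac j k p.2.1 =
      -christoffelT h p.1 * c.dτinv p.1 * ∑ k, c.Jac j k p.2.1 * p.2.2 k := by
    rw [Finset.mul_sum]
    exact Finset.sum_congr rfl fun k _ => by ring
  rw [hsum, pt_yc]
  simp only [Φ, yc, c.christoffelT_transform law hd hd' hne]
  linear_combination (-(c.dτinv p.1 * christoffelT h p.1 + deriv c.dτinv p.1) *
    ∑ k, c.Jac j k p.2.1 * p.2.2 k) * hτ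

/-- The fibre derivatives of the components of a spatial spray form a spatial nonlinear
connection. -/
lemma spatialNLCLaw_of_spray {G G' : J1 n → Fin n → ℝ}
    (hG : ∀ i, Differentiable ℝ fun p => G p i) (hG' : ∀ i, Differentiable ℝ fun p => G' p i)
    (law : ∀ p, (c.dτinv p.1 ^ 2) • (c.jacMatrix p.2.1).mulVec (G p) =
      G' (c.Φ p) + (c.dτinv p.1 / 2) • c.fibreDrift p) :
    SpatialNLCLaw c (fun p i j => py (fun q => G q i) j p)
      (fun p i j => py (fun q => G' q i) j p) := by
  intro p a m
  have h1 : HasDerivAt (fun s => c.dτinv p.1 ^ 2 * ∑ k, c.Jac a k p.2.1 *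
      G (p.1, p.2.1, Function.update p.2.2 m s) k)
      (c.dτinv p.1 ^ 2 * ∑ k, c.Jac a k p.2.1 * py (fun q => G q k) m p) (p.2.2 m) :=
    (HasDerivAt.fun_sum fun k _ => (hasDerivAt_py (hG k) m p).const_mul _).const_mul _
  have h2 := (c.hasDerivAt_comp_Φ_fibre (hG' a) p m).add
    ((c.hasDerivAt_fibreDrift p a m).const_mul (c.dτinv p.1 / 2))
  have h3 := h1.unique (h2.congr_of_eventuallyEq (.of_forall fun s =>
    congrFun (law (p.1, p.2.1, Function.update p.2.2 m s)) a))
  refine mul_left_cancel₀ (c.dτinv_ne_zero p.1) ?_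
  have e1 : c.dτinv p.1 * ∑ k, py (fun q => G' q a) k (c.Φ p) * c.Jac k m p.2.1 =
      ∑ k, py (fun q => G' q a) k (c.Φ p) * (c.Jac k m p.2.1 * c.dτinv p.1) := by
    rw [Finset.mul_sum]
    exact Finset.sum_congr rfl fun k _ => by ring
  have e2 : ∑ k, py (fun q => G q k) m p * c.dτinv p.1 * c.Jac a k p.2.1 =
      c.dτinv p.1 * ∑ k, c.Jac a k p.2.1 * py (fun q => G q k) m p := by
    rw [Finset.mul_sum]
    exact Finset.sum_congr rfl fun k _ => by ring
  rw [e1, e2]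
  linear_combination -h3

end CoordChange

/-- For the canonical time-dependent spray `(H,G)` of a relativistic
rheonomic Lagrange space `RLⁿ = (J¹(ℝ,M), L)` — with `H⁽ⁱ⁾₍₁₎₁ = −(1/2)H¹₁₁yⁱ` and `G` the
canonical spatial spray — the pair `Γ = (M⁽ⁱ⁾₍₁₎₁, N⁽ⁱ⁾₍₁₎ⱼ)` with `M⁽ⁱ⁾₍₁₎₁ = 2H⁽ⁱ⁾₍₁₎₁ =
−H¹₁₁yⁱ` and `N⁽ⁱ⁾₍₁₎ⱼ = ∂G⁽ⁱ⁾₍₁₎₁/∂yʲ` satisfies the temporal and spatial nonlinear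
connection transformation laws: it is the canonical nonlinear connection of `RLⁿ`. -/
theorem canonical_nonlinear_connection_of_lagrange_space
    {n : ℕ} (c : CoordChange n) (h h' : ℝ → ℝ) (L L' : J1 n → ℝ)
    (g g' : J1 n → Matrix (Fin n) (Fin n) ℝ)
    (lawh : TemporalMetricLaw c h h')
    (hL : ContDiff ℝ (⊤ : ℕ∞) L) (hL' : ContDiff ℝ (⊤ : ℕ∞) L')
    (hsm : ContDiff ℝ (⊤ : ℕ∞) h) (hsm' : ContDiff ℝ (⊤ : ℕ∞) h')
    (hne : ∀ t, h t ≠ 0) (hne' : ∀ t, h' t ≠ 0)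
    (hLglobal : ∀ p : J1 n, L' (c.Φ p) = L p)
    (hreg : KroneckerHRegular h L g) (hreg' : KroneckerHRegular h' L' g')
    (gsymm : ∀ p i j, g p i j = g p j i) (g'symm : ∀ p i j, g' p i j = g' p j i)
    (gunit : ∀ p, IsUnit (g p).det) (g'unit : ∀ p, IsUnit (g' p).det) :
    TemporalNLCLaw c
      (fun p i => -(christoffelT h p.1) * p.2.2 i)
      (fun p i => -(christoffelT h' p.1) * p.2.2 i) ∧
    SpatialNLCLaw c
      (fun p i j => py (fun q => canonicalG h L g q i) j p)
      (fun p i j => py (fun q => canonicalG h' L' g' q i) j p) := by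
  obtain rfl : L = fun p => L' (c.Φ p) := funext fun p => (hLglobal p).symm
  have hd := contDiff_differentiable hsm
  have hd' := contDiff_differentiable hsm'
  refine ⟨c.temporalNLCLaw_christoffelT lawh hd hd' hne, c.spatialNLCLaw_of_spray
    (fun i => contDiff_differentiable (contDiff_canonicalG hL hsm hne hreg gunit i))
    (fun i => contDiff_differentiable (contDiff_canonicalG hL' hsm' hne' hreg' g'unit i))
    (c.canonicalG_transform lawh hL' hd hd' hne hreg hreg' g'unit)⟩

end Jet
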